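/- Let K be a field, W ⊆ K^E a realization of a connected matroid M, and H a proper handle of M (H ≠ E). Then, after suitably rescaling the coordinates x_h for h ∈ H and for suitable choices of bases (i.e., up to nonzero square constant factors), the configuration polynomial satisfies ψ_W = Σ_{h∈H} x^{H∖{h}} · ψ_{W∖H} + x^H · ψ_{W/H}, where x^S = Π_{e∈S} x_e. Equivalently, ψ_W = ψ_{W/(E∖H)} · ψ_{W∖H} + ψ_{W|_H} · ψ_{W/H} with ψ_{W|_H} = x^H and ψ_{W/(E∖H)} = Σ_{h∈H} x^{H∖{h}} after suitable scaling. -/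

import Mathlib

open scoped BigOperators

namespace Config

variable {K : Type} [Field K] {E : Type} [Fintype E] [DecidableEq E]

/-- The coordinate functional `e^∨` of `K^E` restricted to a subspace `W ⊆ K^E`. -/
noncomputable def coordFun (W : Submodule K (E → K)) (e : E) : W →ₗ[K] K :=
  (LinearMap.proj e).comp W.subtype

/-- `S ⊆ E` is independent in the matroid `M_W` realized by the configuration `W`:
the restricted coordinate functionals `(e^∨|_W)_{e ∈ S}` are linearly independent. -/
def Indep (W : Submodule K (E → K)) (S : Finset E) : Prop :=
  LinearIndependent K (fun e : S => coordFun W e)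

/-- A circuit of the matroid `M_W`: a minimal dependent subset of `E`. -/
def IsCircuit (W : Submodule K (E → K)) (C : Finset E) : Prop :=
  ¬ Indep W C ∧ ∀ D ⊂ C, Indep W D

/-- The matroid `M_W` is connected: the ground set is nonempty and any two distinct
elements lie on a common circuit. -/
def Connected (W : Submodule K (E → K)) : Prop :=
  Nonempty E ∧ ∀ e f : E, e ≠ f → ∃ C : Finset E, IsCircuit W C ∧ e ∈ C ∧ f ∈ C

/-- A handle of the matroid `M_W`: a nonempty subset `H ⊆ E` such that every circuit
meeting `H` contains `H`. -/
def Handle (W : Submodule K (E → K)) (H : Finset E) : Prop :=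
  H.Nonempty ∧ ∀ C : Finset E, IsCircuit W C → (∃ x ∈ C, x ∈ H) → H ⊆ C

/-- `w` is a (linear) basis of the configuration `W ⊆ K^E`. -/
def IsBasisOf {r : ℕ} (w : Fin r → E → K) (W : Submodule K (E → K)) : Prop :=
  LinearIndependent K w ∧ Submodule.span K (Set.range w) = W

/-- The coefficient `c_{W,B} = (det (w^i_e)_{1≤i≤r, e∈B})²`, the squared determinant of
the `r × r` submatrix of the coefficient matrix of `w` with column set `B` (the square
is independent of the chosen ordering of the columns). -/
noncomputable def cSq {r : ℕ} (w : Fin r → E → K) (B : Finset E) : K :=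
  if h : B.card = r then
    (Matrix.det (Matrix.of fun i j : Fin r =>
      w i ((Finset.equivFinOfCardEq h).symm j : E))) ^ 2
  else 0

/-- The configuration polynomial `ψ_W = ∑_B c_{W,B} · x^B` computed from the basis `w`
(the coefficient `c_{W,B}` vanishes unless `B` is a basis of the matroid `M_W`). -/
noncomputable def psi {r : ℕ} (w : Fin r → E → K) : MvPolynomial E K :=
  ∑ B ∈ Finset.univ.powersetCard r,
    MvPolynomial.C (cSq w B) * ∏ e ∈ B, MvPolynomial.X e

/-- The restriction configuration `W|_F ⊆ K^F`: the image of `W` under the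
coordinate projection `K^E ↠ K^F`. -/
noncomputable def restrictConfig (W : Submodule K (E → K)) (F : Finset E) :
    Submodule K ({x : E // x ∈ F} → K) :=
  W.map (LinearMap.funLeft K K (fun x : {x : E // x ∈ F} => (x : E)))

/-- The deletion configuration `W ∖ F = W|_{E ∖ F} ⊆ K^{E ∖ F}`. -/
noncomputable def deleteConfig (W : Submodule K (E → K)) (F : Finset E) :
    Submodule K ({x : E // x ∉ F} → K) :=
  W.map (LinearMap.funLeft K K (fun x : {x : E // x ∉ F} => (x : E)))

/-- The contraction configuration `W/F = W ∩ K^{E ∖ F} ⊆ K^{E ∖ F}`: the vectors of `W`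
vanishing on `F`, viewed in the coordinates `E ∖ F`. -/
noncomputable def contractConfig (W : Submodule K (E → K)) (F : Finset E) :
    Submodule K ({x : E // x ∉ F} → K) :=
  (W ⊓ LinearMap.ker (LinearMap.funLeft K K (fun x : {x : E // x ∈ F} => (x : E)))).map
    (LinearMap.funLeft K K (fun x : {x : E // x ∉ F} => (x : E)))

set_option linter.unusedSectionVars false

/-- The relation `a` annihilates `W`. -/
def Rel (W : Submodule K (E → K)) (a : E → K) : Prop :=
  ∀ v ∈ W, ∑ e, a e * v e = 0

lemma indep_iff (W : Submodule K (E → K)) (S : Finset E) :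
    Indep W S ↔ ∀ a : E → K, (∀ e ∉ S, a e = 0) → Rel W a → a = 0 := by
  unfold Indep
  rw [Fintype.linearIndependent_iff]
  constructor
  · intro h a ha hr
    have h1 := h (fun e => a e) (by
      ext v
      have h2 := hr v v.2
      rw [← Finset.sum_subset (Finset.subset_univ S) (by
        intro e _ he; rw [ha e he, zero_mul])] at h2
      rw [← Finset.sum_coe_sort] at h2
      simpa [coordFun] using h2)
    funext e
    by_cases he : e ∈ S
    · exact h1 ⟨e, he⟩
    · exact ha e he
  · intro h g hg i
    have h1 := h (fun e => if he : e ∈ S then g ⟨e, he⟩ else 0) (by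
      intro e he; simp [he]) (by
      intro v hv
      rw [← Finset.sum_subset (Finset.subset_univ S) (by
        intro e _ he; simp [he])]
      rw [← Finset.sum_coe_sort]
      have := LinearMap.congr_fun hg ⟨v, hv⟩
      simpa [coordFun] using this)
    have := congrFun h1 i
    simpa using this

lemma rel_sub {W : Submodule K (E → K)} {a b : E → K} (ha : Rel W a) (hb : Rel W b) (t : K) :
    Rel W (fun e => a e - t * b e) := by
  intro v hv
  have h1 := ha v hv
  have h2 := hb v hv
  have : ∑ e, (a e - t * b e) * v e = ∑ e, a e * v e - t * ∑ e, b e * v e := by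
    rw [Finset.mul_sum, ← Finset.sum_sub_distrib]
    refine Finset.sum_congr rfl fun e _ => by ring
  rw [this, h1, h2]; simp

open Classical in
lemma handle_rel {W : Submodule K (E → K)} {H : Finset E} (hH : Handle W H) :
    ∀ (n : ℕ) (a : E → K), (Finset.univ.filter fun e => a e ≠ 0).card = n → Rel W a →
      (∃ h ∈ H, a h ≠ 0) → ∀ h ∈ H, a h ≠ 0 := by
  intro n
  induction n using Nat.strong_induction_on with
  | _ n ih =>
    intro a hn hr hex h hh
    set S := Finset.univ.filter fun e => a e ≠ 0 with hS
    by_cases hall : ∀ D ⊂ S, Indep W D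
    · have hdep : ¬ Indep W S := by
        rw [indep_iff]
        intro h0
        have := h0 a (by intro e he; simpa [hS] using he) hr
        obtain ⟨h, _, h2⟩ := hex
        exact h2 (by rw [this]; rfl)
      obtain ⟨x, hx, hx2⟩ := hex
      have := hH.2 S ⟨hdep, hall⟩ ⟨x, by simpa [hS] using hx2, hx⟩ hh
      simpa [hS] using this
    · push Not at hall
      obtain ⟨D, hD, hDi⟩ := hall
      rw [indep_iff] at hDi
      push Not at hDi
      obtain ⟨b, hbD, hbr, hb0⟩ := hDi
      have hbS : (Finset.univ.filter fun e => b e ≠ 0) ⊆ D := by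
        intro e he
        by_contra hc
        simp [hbD e hc] at he
      by_cases hbH : ∃ h ∈ H, b h ≠ 0
      · have := ih _ (by
          rw [← hn]
          exact Finset.card_lt_card (lt_of_le_of_lt hbS hD)) b rfl hbr hbH h hh
        have h2 : h ∈ S := hD.1 (hbS (by simpa using this))
        simpa [hS] using h2
      · push Not at hbH
        obtain ⟨f, hf⟩ := Function.ne_iff.mp hb0
        have hf : b f ≠ 0 := hf
        have hfS : f ∈ S := hD.1 (hbS (by simpa using hf))
        have hlt : (Finset.univ.filter fun e => a e - (a f / b f) * b e ≠ 0) ⊂ S := by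
          rw [Finset.ssubset_iff_of_subset]
          · exact ⟨f, hfS, by simp [hf]⟩
          · intro e he
            by_contra hc
            have h1 : a e = 0 := by simpa [hS] using hc
            have h2 : b e = 0 := by
              by_contra h3
              exact hc (hD.1 (hbS (by simpa using h3)))
            simp [h1, h2] at he
        have := ih _ (by rw [← hn]; exact Finset.card_lt_card hlt)
          (fun e => a e - (a f / b f) * b e) rfl (rel_sub hr hbr _) (by
            obtain ⟨x, hx, hx2⟩ := hex
            exact ⟨x, hx, by simpa [hbH x hx] using hx2⟩) h hh
        simpa [hbH h hh] using this

lemma exists_c {W : Submodule K (E → K)} {H : Finset E}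
    (hconn : Connected W) (hH : Handle W H) (hproper : H ≠ Finset.univ) :
    Indep W H ∧ ∃ c : E → K, Rel W c ∧ ∀ h ∈ H, c h ≠ 0 := by
  obtain ⟨h, hh⟩ := hH.1
  obtain ⟨f, hf⟩ : ∃ f, f ∉ H := by
    by_contra hc
    push Not at hc
    exact hproper (Finset.eq_univ_iff_forall.mpr hc)
  obtain ⟨C, hC, hhC, hfC⟩ := hconn.2 h f (by rintro rfl; exact hf hh)
  have hHC : H ⊆ C := hH.2 C hC ⟨h, hhC, hh⟩
  refine ⟨hC.2 H ((Finset.ssubset_iff_of_subset hHC).mpr ⟨f, hfC, hf⟩), ?_⟩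
  have hdep := hC.1
  rw [indep_iff] at hdep
  push Not at hdep
  obtain ⟨c, hcC, hcr, hc0⟩ := hdep
  refine ⟨c, hcr, fun x hx hcx => hc0 ?_⟩
  refine (indep_iff W (C.erase x)).mp (hC.2 _ (Finset.erase_ssubset (hHC hx))) c ?_ hcr
  intro e he
  by_cases hex : e = x
  · rw [hex, hcx]
  · exact hcC e (by intro h2; exact he (Finset.mem_erase.mpr ⟨hex, h2⟩))

lemma mem_of_rel {W : Submodule K (E → K)} {z : E → K}
    (hz : ∀ a, Rel W a → ∑ e, a e * z e = 0) : z ∈ W := by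
  by_contra hc
  obtain ⟨φ, hφ, hle⟩ := Submodule.exists_le_ker_of_notMem hc
  have key : ∀ v : E → K, φ v = ∑ e, φ (Pi.single e 1) * v e := by
    intro v
    conv_lhs => rw [← Finset.univ_sum_single v]
    rw [map_sum]
    refine Finset.sum_congr rfl fun e _ => ?_
    have : (Pi.single e (v e) : E → K) = v e • Pi.single e 1 := by
      rw [← Pi.single_smul]; simp
    rw [this, map_smul, smul_eq_mul, mul_comm]
  exact hφ (by
    rw [key]
    exact hz _ (fun v hv => by rw [← key]; exact hle hv))

lemma mem_of_c {W : Submodule K (E → K)} {H : Finset E} (hH : Handle W H) {c : E → K}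
    (hc : Rel W c) (hcH : ∀ h ∈ H, c h ≠ 0) {z : E → K} (hz : ∀ e ∉ H, z e = 0)
    (hcz : ∑ e, c e * z e = 0) : z ∈ W := by
  refine mem_of_rel fun a ha => ?_
  obtain ⟨h0, hh0⟩ := hH.1
  set t := a h0 / c h0
  have h1 : ∀ h ∈ H, a h - t * c h = 0 := by
    by_contra hne
    push Not at hne
    have := handle_rel hH _ (fun e => a e - t * c e) rfl (rel_sub ha hc t) hne h0 hh0
    apply this
    have := hcH h0 hh0
    simp only [t]
    field_simp
    ring
  have : ∑ e, a e * z e = ∑ e, t * (c e * z e) := by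
    refine Finset.sum_congr rfl fun e _ => ?_
    by_cases he : e ∈ H
    · rw [sub_eq_zero.mp (h1 e he)]; ring
    · rw [hz e he]; ring
  rw [this, ← Finset.mul_sum, hcz, mul_zero]

lemma exists_lift {W : Submodule K (E → K)} {H : Finset E} (hI : Indep W H) :
    W.map (LinearMap.funLeft K K (fun x : {x : E // x ∈ H} => (x : E))) = ⊤ := by
  rw [eq_top_iff]
  intro z _
  refine mem_of_rel fun a ha => ?_
  have h0 := (Fintype.linearIndependent_iff.mp hI) a (by
    ext v
    have := ha _ (Submodule.mem_map_of_mem v.2)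
    simpa [coordFun, LinearMap.funLeft_apply] using this)
  simp [h0]

lemma ses {ι κ V V' : Type} [AddCommGroup V] [Module K V] [AddCommGroup V'] [Module K V']
    (π : V →ₗ[K] V') (W : Submodule K V) (y : ι → V) (x : κ → V)
    (hx : LinearIndependent K x) (hxs : Submodule.span K (Set.range x) = W ⊓ LinearMap.ker π)
    (hyW : ∀ i, y i ∈ W)
    (hy : LinearIndependent K (π ∘ y))
    (hys : Submodule.span K (Set.range (π ∘ y)) = W.map π) :
    LinearIndependent K (Sum.elim y x) ∧
      Submodule.span K (Set.range (Sum.elim y x)) = W := by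
  have hyy : LinearIndependent K y := LinearIndependent.of_comp π hy
  constructor
  · refine LinearIndependent.sum_type hyy hx ?_
    rw [Submodule.disjoint_def]
    intro v hv hv2
    rw [hxs] at hv2
    have hk : π v = 0 := hv2.2
    have hdis := (Submodule.range_ker_disjoint (f := π) (v := y) hy)
    rw [Submodule.disjoint_def] at hdis
    exact hdis v hv hk
  · rw [Set.Sum.elim_range, Submodule.span_union, hxs]
    apply le_antisymm
    · refine sup_le (Submodule.span_le.mpr ?_) inf_le_left
      rintro _ ⟨i, rfl⟩
      exact hyW i
    · intro v hv
      have h1 : π v ∈ Submodule.span K (Set.range (π ∘ y)) := by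
        rw [hys]; exact Submodule.mem_map_of_mem hv
      rw [Set.range_comp, Submodule.span_image] at h1
      obtain ⟨u, hu, huv⟩ := h1
      have huW : u ∈ W := (Submodule.span_le.mpr (by rintro _ ⟨i, rfl⟩; exact hyW i)) hu
      rw [Submodule.mem_sup]
      refine ⟨u, hu, v - u, ⟨W.sub_mem hv huW, ?_⟩, by abel⟩
      change π (v - u) = 0
      rw [map_sub, huv, sub_self]

lemma cSq_basis {W : Submodule K (E → K)} {r : ℕ} {w : Fin r → E → K} (hw : IsBasisOf w W)
    {ι : Type} [Fintype ι] [DecidableEq ι] {y : ι → E → K} (hy : LinearIndependent K y)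
    (hys : Submodule.span K (Set.range y) = W) :
    r = Fintype.card ι ∧ ∃ d : K, d ≠ 0 ∧ ∀ f : ι → E, Function.Injective f →
      cSq w (Finset.univ.image f) = d ^ 2 * (Matrix.det (Matrix.of fun i j => y i (f j))) ^ 2 := by
  obtain ⟨hwl, hws⟩ := hw
  subst hws
  let bw := Module.Basis.span hwl
  let by' := (Module.Basis.span hy).map (LinearEquiv.ofEq _ _ hys)
  have hbw : ∀ i, ((bw i : Submodule.span K (Set.range w)) : E → K) = w i := fun i =>
    congrArg Subtype.val (Module.Basis.span_apply hwl i) |>.trans rfl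
  have hby : ∀ i, ((by' i : Submodule.span K (Set.range w)) : E → K) = y i := fun i => by
    simp [by', Module.Basis.span_apply]
  let g : Fin r ≃ ι := bw.indexEquiv by'
  have hr : r = Fintype.card ι := by simpa using Fintype.card_congr g
  let bw' := bw.reindex g
  refine ⟨hr, (by'.toMatrix bw').det, ?_, ?_⟩
  · have := by'.isUnit_det bw'
    rw [Module.Basis.det_apply] at this
    exact this.ne_zero
  intro f hf
  have hcard : (Finset.univ.image f).card = r := by
    rw [Finset.card_image_of_injective _ hf, hr, Finset.card_univ]
  unfold cSq
  rw [dif_pos hcard]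
  have hP : ∀ j : Fin r, ∃ i : ι, f i = ((Finset.equivFinOfCardEq hcard).symm j : E) := by
    intro j
    obtain ⟨i, -, hi⟩ := Finset.mem_image.mp ((Finset.equivFinOfCardEq hcard).symm j).2
    exact ⟨i, hi⟩
  choose P hP using hP
  have hPinj : Function.Injective P := by
    intro i j hij
    have : ((Finset.equivFinOfCardEq hcard).symm i : E) = (Finset.equivFinOfCardEq hcard).symm j := by
      rw [← hP, ← hP, hij]
    exact (Finset.equivFinOfCardEq hcard).symm.injective (Subtype.ext this)
  have hσinj : Function.Injective (P ∘ g.symm) := hPinj.comp g.symm.injective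
  let σ : Equiv.Perm ι := Equiv.ofBijective _ (Finite.injective_iff_bijective.mp hσinj)
  have hM : (Matrix.of fun i j : Fin r => w i ((Finset.equivFinOfCardEq hcard).symm j : E))
      = (((by'.toMatrix bw').transpose * (Matrix.of fun i j => y i (f j)).submatrix id σ)).submatrix
        g g := by
    ext i j
    have h1 := by'.sum_toMatrix_smul_self bw' (g i)
    have h2 := congrFun (congrArg Subtype.val h1) (f (P j))
    have h3 : ((bw' (g i) : Submodule.span K (Set.range w)) : E → K) = w i := by
      simp [bw', hbw]
    rw [h3] at h2
    simp only [Matrix.of_apply, Matrix.submatrix_apply, Matrix.mul_apply, Matrix.transpose_apply,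
      id]
    rw [← hP, ← h2]
    have h4 : σ (g j) = P j := by simp [σ]
    rw [h4]
    rw [Submodule.coe_sum, Finset.sum_apply]
    refine Finset.sum_congr rfl fun k _ => ?_
    rw [Submodule.coe_smul, hby]
    rfl
  rw [hM, Matrix.det_submatrix_equiv_self, Matrix.det_mul, Matrix.det_transpose,
    Matrix.det_permute', mul_pow, mul_pow]
  have hs : (((Equiv.Perm.sign σ : ℤˣ) : ℤ) : K) ^ 2 = 1 := by
    rcases Int.units_eq_one_or (Equiv.Perm.sign σ) with h | h <;> simp [h]
  rw [hs, one_mul]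

lemma cSq_self {r : ℕ} (w : Fin r → E → K) (f : Fin r → E) (hf : Function.Injective f) :
      cSq w (Finset.univ.image f) = (Matrix.det (Matrix.of fun i j => w i (f j))) ^ 2 := by
  have hcard : (Finset.univ.image f).card = r := by
    rw [Finset.card_image_of_injective _ hf]; simp
  unfold cSq
  rw [dif_pos hcard]
  have hP : ∀ j : Fin r, ∃ i : Fin r, f i = ((Finset.equivFinOfCardEq hcard).symm j : E) := by
    intro j
    obtain ⟨i, -, hi⟩ := Finset.mem_image.mp ((Finset.equivFinOfCardEq hcard).symm j).2
    exact ⟨i, hi⟩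
  choose P hP using hP
  have hPinj : Function.Injective P := by
    intro i j hij
    have : ((Finset.equivFinOfCardEq hcard).symm i : E) = (Finset.equivFinOfCardEq hcard).symm j := by
      rw [← hP, ← hP, hij]
    exact (Finset.equivFinOfCardEq hcard).symm.injective (Subtype.ext this)
  let σ : Equiv.Perm (Fin r) := Equiv.ofBijective _ (Finite.injective_iff_bijective.mp hPinj)
  have hM : (Matrix.of fun i j : Fin r => w i ((Finset.equivFinOfCardEq hcard).symm j : E))
      = (Matrix.of fun i j => w i (f j)).submatrix id σ := by
    ext i j
    simp [σ, hP]
  rw [hM, Matrix.det_permute', mul_pow]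
  have hs : (((Equiv.Perm.sign σ : ℤˣ) : ℤ) : K) ^ 2 = 1 := by
    rcases Int.units_eq_one_or (Equiv.Perm.sign σ) with h | h <;> simp [h]
  rw [hs, one_mul]

lemma cSq_zero {W : Submodule K (E → K)} {r : ℕ} {w : Fin r → E → K} (hw : IsBasisOf w W)
    (B : Finset E) {z : E → K} (hz : z ∈ W) (hz0 : z ≠ 0) (hzB : ∀ e ∈ B, z e = 0) :
    cSq w B = 0 := by
  unfold cSq
  split_ifs with h
  · rw [← hw.2] at hz
    obtain ⟨t, ht⟩ := (Submodule.mem_span_range_iff_exists_fun K).mp hz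
    have : (Matrix.of fun i j : Fin r =>
      w i ((Finset.equivFinOfCardEq h).symm j : E)).det = 0 := by
      rw [← Matrix.exists_vecMul_eq_zero_iff]
      refine ⟨t, ?_, ?_⟩
      · rintro rfl
        apply hz0; rw [← ht]; simp
      · ext j
        have := hzB _ ((Finset.equivFinOfCardEq h).symm j).2
        rw [← ht] at this
        simpa [Matrix.vecMul, dotProduct, Finset.sum_apply] using this
    rw [this]; simp
  · rfl

lemma psi_eq {r : ℕ} (w : Fin r → E → K) :
    psi w = ∑ B : Finset E, MvPolynomial.C (cSq w B) * ∏ e ∈ B, MvPolynomial.X e := by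
  unfold psi
  refine Finset.sum_subset (Finset.subset_univ _) ?_
  intro B _ hB
  have : B.card ≠ r := by
    intro h; exact hB (by simp [Finset.mem_powersetCard, h])
  simp [cSq, this]

lemma exists_param {α : Type} [DecidableEq α] {s : ℕ} {B : Finset α} (h : B.card = s) :
    ∃ f : Fin s → α, Function.Injective f ∧ Finset.univ.image f = B := by
  refine ⟨fun j => ((Finset.equivFinOfCardEq h).symm j : α), ?_, ?_⟩
  · exact Subtype.val_injective.comp (Finset.equivFinOfCardEq h).symm.injective
  · ext x
    simp only [Finset.mem_image, Finset.mem_univ, true_and]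
    constructor
    · rintro ⟨j, rfl⟩; exact ((Finset.equivFinOfCardEq h).symm j).2
    · intro hx
      exact ⟨Finset.equivFinOfCardEq h ⟨x, hx⟩, by simp⟩

lemma card_union {H A : Finset E} (hA : A ⊆ H) (B : Finset {x : E // x ∉ H}) :
    (A ∪ B.map (Function.Embedding.subtype _)).card = A.card + B.card := by
  rw [Finset.card_union_of_disjoint, Finset.card_map]
  rw [Finset.disjoint_left]
  intro e he he2
  obtain ⟨x, _, rfl⟩ := Finset.mem_map.mp he2
  exact x.2 (hA he)

lemma case_full {W : Submodule K (E → K)} {H : Finset E} {r rc : ℕ}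
    {w : Fin r → E → K} {wc : Fin rc → {x : E // x ∉ H} → K}
    (hw : IsBasisOf w W) (hwc : IsBasisOf wc (contractConfig W H)) (hI : Indep W H) :
    ∃ d : K, d ≠ 0 ∧ ∀ B : Finset {x : E // x ∉ H},
      cSq w (H ∪ B.map (Function.Embedding.subtype _)) = d ^ 2 * cSq wc B := by
  let π := LinearMap.funLeft K K (fun x : {x : E // x ∈ H} => (x : E))
  have htop : W.map π = ⊤ := exists_lift hI
  have hp : ∀ h : {x : E // x ∈ H}, ∃ p ∈ W, π p = Pi.single h 1 := by
    intro h
    have : (Pi.single h 1 : {x : E // x ∈ H} → K) ∈ W.map π := by rw [htop]; trivial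
    simpa using this
  choose p hpW hp using hp
  let ext : ({x : E // x ∉ H} → K) →ₗ[K] (E → K) :=
    Function.ExtendByZero.linearMap K (Subtype.val)
  have hext1 : ∀ z (e : {x : E // x ∉ H}), ext z e = z e := fun z e =>
    Subtype.val_injective.extend_apply z 0 e
  have hext2 : ∀ z, ∀ e ∈ H, ext z e = 0 := fun z e he =>
    Function.extend_apply' (f := (Subtype.val : {x : E // x ∉ H} → E)) z (0 : E → K) e
      (by rintro ⟨a, rfl⟩; exact a.2 he)
  have hextinj : LinearMap.ker ext = ⊥ := by
    rw [LinearMap.ker_eq_bot]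
    intro a b hab
    funext e
    rw [← hext1 a e, hab, hext1]
  have hπp : π ∘ p = fun h => Pi.single h (1 : K) := funext hp
  obtain ⟨hli, hsp⟩ := ses π W p (ext ∘ wc) (hwc.1.map' ext hextinj)
    (by
      rw [Set.range_comp, Submodule.span_image, hwc.2]
      apply le_antisymm
      · rintro _ ⟨_, ⟨v, ⟨hv, hv0⟩, rfl⟩, rfl⟩
        have hv0 : π v = 0 := hv0
        have : ext (LinearMap.funLeft K K (fun x : {x : E // x ∉ H} => (x : E)) v) = v := by
          funext e
          by_cases he : e ∈ H
          · rw [hext2 _ e he]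
            exact (congrFun hv0 ⟨e, he⟩).symm
          · exact hext1 _ ⟨e, he⟩
        rw [this]
        exact ⟨hv, hv0⟩
      · rintro v ⟨hv, hv0⟩
        refine ⟨_, ⟨v, ⟨hv, hv0⟩, rfl⟩, ?_⟩
        have hv0 : π v = 0 := hv0
        funext e
        by_cases he : e ∈ H
        · rw [hext2 _ e he]
          exact (congrFun hv0 ⟨e, he⟩).symm
        · exact hext1 _ ⟨e, he⟩)
    hpW
    (by
      rw [hπp]
      have := (Pi.basisFun K {x : E // x ∈ H}).linearIndependent
      have he : (fun h => Pi.single h (1 : K)) = ⇑(Pi.basisFun K {x : E // x ∈ H}) := by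
        funext h; simp
      rw [he]; exact this)
    (by
      rw [hπp, htop]
      have := (Pi.basisFun K {x : E // x ∈ H}).span_eq
      have he : (fun h => Pi.single h (1 : K)) = ⇑(Pi.basisFun K {x : E // x ∈ H}) := by
        funext h; simp
      rw [he]; exact this)
  obtain ⟨hr, d, hd, hdf⟩ := cSq_basis hw hli hsp
  refine ⟨d, hd, fun B => ?_⟩
  by_cases hB : B.card = rc
  · obtain ⟨f, hf, hfB⟩ := exists_param hB
    have hinj : Function.Injective (Sum.elim (fun h : {x : E // x ∈ H} => (h : E))
        (fun i => (f i : E))) := by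
      refine Function.Injective.sumElim Subtype.val_injective (Subtype.val_injective.comp hf) ?_
      intro a b hab
      exact (f b).2 (hab ▸ a.2)
    have him : Finset.univ.image (Sum.elim (fun h : {x : E // x ∈ H} => (h : E))
        (fun i => (f i : E))) = H ∪ B.map (Function.Embedding.subtype _) := by
      rw [← hfB]
      ext e
      simp
    rw [← him, hdf _ hinj, ← hfB, cSq_self wc f hf]
    congr 2
    have : (Matrix.of fun i j => Sum.elim p (ext ∘ wc) i (Sum.elim
        (fun h : {x : E // x ∈ H} => (h : E)) (fun i => (f i : E)) j)) =
        Matrix.fromBlocks 1 (Matrix.of fun i j => p i (f j)) 0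
          (Matrix.of fun i j => wc i (f j)) := by
      ext i j
      rcases i with i | i <;> rcases j with j | j
      · have := congrFun (hp i) j
        simp only [Matrix.of_apply, Sum.elim_inl, Matrix.fromBlocks_apply₁₁]
        rw [Matrix.one_apply]
        change p i j = _ at this
        rw [this, Pi.single_apply]
        simp [eq_comm]
      · simp
      · simp [hext2]
      · simp [hext1]
    rw [this, Matrix.det_fromBlocks_zero₂₁, Matrix.det_one, one_mul]
  · have h1 : (H ∪ B.map (Function.Embedding.subtype _)).card ≠ r := by
      rw [card_union (Finset.Subset.refl H), hr]
      simp only [Fintype.card_sum, Fintype.card_coe, Fintype.card_fin]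
      omega
    simp [cSq, h1, hB]

lemma detV {H : Finset E} {c : E → K} (hcH : ∀ h ∈ H, c h ≠ 0) {h0 h : E} (hh0 : h0 ∈ H)
    (hh : h ∈ H) :
    (Matrix.det (Matrix.of fun i j : {x : E // x ∈ H.erase h0} =>
      (Pi.single (i : E) (c i)⁻¹ - Pi.single h0 (c h0)⁻¹ : E → K) (Equiv.swap h h0 j))) ^ 2
      = (∏ e ∈ H, (c e)⁻¹) ^ 2 * c h ^ 2 := by
  have hprod : ∏ i : {x : E // x ∈ H.erase h0}, (c i)⁻¹ = c h0 * ∏ e ∈ H, (c e)⁻¹ := by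
    rw [← Finset.mul_prod_erase H _ hh0, Finset.prod_coe_sort (H.erase h0) (fun e => (c e)⁻¹)]
    rw [← mul_assoc, mul_inv_cancel₀ (hcH h0 hh0), one_mul]
  by_cases hhh : h = h0
  · subst hhh
    have : (Matrix.of fun i j : {x : E // x ∈ H.erase h} =>
      (Pi.single (i : E) (c i)⁻¹ - Pi.single h (c h)⁻¹ : E → K) (Equiv.swap h h j)) =
      Matrix.diagonal fun i : {x : E // x ∈ H.erase h} => (c i)⁻¹ := by
      ext i j
      have hj : (j : E) ≠ h := (Finset.mem_erase.mp j.2).1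
      simp only [Matrix.of_apply, Equiv.swap_self, Equiv.refl_apply, Pi.sub_apply]
      by_cases hij : i = j
      · subst hij; simp [hj]
      · have : (j : E) ≠ i := fun h => hij (Subtype.ext h.symm)
        simp [hij, hj, this]
    rw [this, Matrix.det_diagonal, hprod]
    ring
  · let k : {x : E // x ∈ H.erase h0} := ⟨h, Finset.mem_erase.mpr ⟨hhh, hh⟩⟩
    have : (Matrix.of fun i j : {x : E // x ∈ H.erase h0} =>
      (Pi.single (i : E) (c i)⁻¹ - Pi.single h0 (c h0)⁻¹ : E → K) (Equiv.swap h h0 j)) =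
      (Matrix.diagonal fun i : {x : E // x ∈ H.erase h0} => (c i)⁻¹).updateCol k
        (fun _ => -(c h0)⁻¹) := by
      ext i j
      have hi : (i : E) ≠ h0 := (Finset.mem_erase.mp i.2).1
      have hj : (j : E) ≠ h0 := (Finset.mem_erase.mp j.2).1
      rw [Matrix.updateCol_apply]
      by_cases hjk : j = k
      · have hjh : (j : E) = h := congrArg Subtype.val hjk
        simp [hjk, k, hi.symm]
      · have hjh : (j : E) ≠ h := fun hx => hjk (Subtype.ext hx)
        simp only [Matrix.of_apply, if_neg hjk]
        rw [Equiv.swap_apply_of_ne_of_ne hjh hj]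
        by_cases hij : i = j
        · subst hij; simp [hj]
        · have : (j : E) ≠ i := fun h => hij (Subtype.ext h.symm)
          simp [hij, hj, this]
    rw [this, ← Matrix.cramer_apply]
    have h1 := congrFun (Matrix.mulVec_cramer
      (Matrix.diagonal fun i : {x : E // x ∈ H.erase h0} => (c i)⁻¹) (fun _ => -(c h0)⁻¹)) k
    rw [Matrix.mulVec_diagonal, Matrix.det_diagonal, hprod] at h1
    simp only [Pi.smul_apply, smul_eq_mul] at h1
    have hk : c k ≠ 0 := hcH h hh
    have hck : c k = c h := rfl
    have h00 := hcH h0 hh0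
    rw [inv_mul_eq_iff_eq_mul₀ hk] at h1
    rw [h1, hck]
    field_simp

lemma case_erase {W : Submodule K (E → K)} {H : Finset E} {r rd : ℕ}
    {w : Fin r → E → K} {wd : Fin rd → {x : E // x ∉ H} → K}
    (hw : IsBasisOf w W) (hwd : IsBasisOf wd (deleteConfig W H)) (hH : Handle W H) {c : E → K}
    (hc : Rel W c) (hcH : ∀ h ∈ H, c h ≠ 0) :
    ∃ d : K, d ≠ 0 ∧ ∀ h ∈ H, ∀ B : Finset {x : E // x ∉ H},
      cSq w (H.erase h ∪ B.map (Function.Embedding.subtype _)) =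
        d ^ 2 * c h ^ 2 * cSq wd B := by
  obtain ⟨h0, hh0⟩ := hH.1
  have h00 := hcH h0 hh0
  let π := LinearMap.funLeft K K (fun x : {x : E // x ∉ H} => (x : E))
  have hp : ∀ i, ∃ p ∈ W, π p = wd i := by
    intro i
    have : wd i ∈ deleteConfig W H := by
      rw [← hwd.2]; exact Submodule.subset_span ⟨i, rfl⟩
    simpa [deleteConfig] using this
  choose p hpW hp using hp
  have hπp : π ∘ p = wd := funext hp
  let v : {x : E // x ∈ H.erase h0} → E → K := fun i =>
    Pi.single (i : E) (c i)⁻¹ - Pi.single h0 (c h0)⁻¹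
  have hvi : ∀ i j : {x : E // x ∈ H.erase h0}, v i j = if i = j then (c j)⁻¹ else 0 := by
    intro i j
    have hj : (j : E) ≠ h0 := (Finset.mem_erase.mp j.2).1
    by_cases hij : i = j
    · subst hij; simp [v, hj]
    · have : (j : E) ≠ i := fun h => hij (Subtype.ext h.symm)
      simp [v, hij, hj, this]
  have hvn : ∀ i, ∀ e ∉ H, v i e = 0 := by
    intro i e he
    have h1 : e ≠ i := by rintro rfl; exact he (Finset.mem_of_mem_erase i.2)
    have h2 : e ≠ h0 := by rintro rfl; exact he hh0
    simp [v, h1, h2]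
  have hv0 : ∀ i, v i h0 = -(c h0)⁻¹ := by
    intro i
    have hi : (i : E) ≠ h0 := (Finset.mem_erase.mp i.2).1
    simp [v, hi.symm]
  have hcne : ∀ i : {x : E // x ∈ H.erase h0}, c i ≠ 0 := fun i =>
    hcH i (Finset.mem_of_mem_erase i.2)
  have hvW : ∀ i, v i ∈ W := by
    intro i
    refine mem_of_c hH hc hcH (hvn i) ?_
    simp [v, mul_sub, Finset.sum_sub_distrib, Pi.single_apply, hcne i, h00]
  have hvli : LinearIndependent K v := by
    rw [Fintype.linearIndependent_iff]
    intro g hg i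
    have := congrFun hg i
    simp only [Finset.sum_apply, Pi.smul_apply, smul_eq_mul, hvi] at this
    simpa [hcne i] using this
  obtain ⟨hli, hsp⟩ := ses π W p v hvli
    (by
      apply le_antisymm
      · rw [Submodule.span_le]
        rintro _ ⟨i, rfl⟩
        exact ⟨hvW i, funext fun e => hvn i e e.2⟩
      · rintro z ⟨hz, hz0⟩
        have hz0 : π z = 0 := hz0
        have hz0 : ∀ e ∉ H, z e = 0 := fun e he => congrFun hz0 ⟨e, he⟩
        rw [Submodule.mem_span_range_iff_exists_fun]
        refine ⟨fun i => c i * z i, ?_⟩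
        funext e
        rw [Finset.sum_apply]
        simp only [Pi.smul_apply, smul_eq_mul]
        by_cases heH : e ∈ H
        · by_cases he0 : e = h0
          · subst he0
            have h1 := hc z hz
            rw [← Finset.sum_subset (Finset.subset_univ H) (by
              intro x _ hx; rw [hz0 x hx, mul_zero]), ← Finset.add_sum_erase H _ heH,
              ← Finset.sum_coe_sort] at h1
            simp only [hv0]
            rw [← Finset.sum_mul, eq_neg_of_add_eq_zero_right h1]
            field_simp
          · let k : {x : E // x ∈ H.erase h0} := ⟨e, Finset.mem_erase.mpr ⟨he0, heH⟩⟩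
            change ∑ i : {x : E // x ∈ H.erase h0}, c i * z i * v i k = z k
            simp only [hvi]
            have := hcne k
            simp
            field_simp
        · rw [hz0 e heH]
          exact Finset.sum_eq_zero fun i _ => by rw [hvn i e heH, mul_zero])
    hpW (by rw [hπp]; exact hwd.1) (by rw [hπp]; exact hwd.2)
  obtain ⟨hr, d, hd, hdf⟩ := cSq_basis hw hli hsp
  refine ⟨d * ∏ e ∈ H, (c e)⁻¹, mul_ne_zero hd
    (Finset.prod_ne_zero_iff.mpr fun e he => inv_ne_zero (hcH e he)), fun h hh B => ?_⟩
  by_cases hB : B.card = rd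
  · obtain ⟨f, hf, hfB⟩ := exists_param hB
    have hsw : ∀ j : E, Equiv.swap h h0 j ∈ H.erase h ↔ j ∈ H.erase h0 := by
      intro j
      by_cases h1 : j = h0
      · subst h1; simp
      · by_cases h2 : j = h
        · subst h2; simp [hh, hh0, h1, Ne.symm h1]
        · rw [Equiv.swap_apply_of_ne_of_ne h2 h1]; simp [h1, h2]
    have hinj : Function.Injective (Sum.elim (fun i => (f i : E))
        (fun j : {x : E // x ∈ H.erase h0} => Equiv.swap h h0 j)) := by
      refine Function.Injective.sumElim (Subtype.val_injective.comp hf)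
        ((Equiv.injective _).comp Subtype.val_injective) ?_
      intro a b hab
      exact (f a).2 (hab ▸ Finset.mem_of_mem_erase ((hsw b).mpr b.2))
    have him : Finset.univ.image (Sum.elim (fun i => (f i : E))
        (fun j : {x : E // x ∈ H.erase h0} => Equiv.swap h h0 j)) =
        H.erase h ∪ B.map (Function.Embedding.subtype _) := by
      rw [← hfB]
      ext e
      rw [Finset.mem_union, Finset.mem_image]
      constructor
      · rintro ⟨i | j, -, rfl⟩
        · right; simp
        · left; exact (hsw j).mpr j.2
      · rintro (he | he)
        · refine ⟨Sum.inr ⟨Equiv.swap h h0 e, (hsw _).mp (by simpa using he)⟩, Finset.mem_univ _, ?_⟩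
          simp
        · obtain ⟨x, hx, rfl⟩ := Finset.mem_map.mp he
          obtain ⟨i, -, rfl⟩ := Finset.mem_image.mp hx
          exact ⟨Sum.inl i, Finset.mem_univ _, rfl⟩
    rw [← him, hdf _ hinj, ← hfB, cSq_self wd f hf]
    have : (Matrix.of fun i j => Sum.elim p v i (Sum.elim (fun i => (f i : E))
        (fun j : {x : E // x ∈ H.erase h0} => Equiv.swap h h0 j) j)) =
        Matrix.fromBlocks (Matrix.of fun i j => wd i (f j))
          (Matrix.of fun i (j : {x : E // x ∈ H.erase h0}) => p i (Equiv.swap h h0 j)) 0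
          (Matrix.of fun i (j : {x : E // x ∈ H.erase h0}) => v i (Equiv.swap h h0 j)) := by
      ext i j
      rcases i with i | i <;> rcases j with j | j
      · exact congrFun (hp i) (f j)
      · rfl
      · exact hvn i _ (f j).2
      · rfl
    rw [this, Matrix.det_fromBlocks_zero₂₁, mul_pow, detV hcH hh0 hh]
    ring
  · have h1 : (H.erase h ∪ B.map (Function.Embedding.subtype _)).card ≠ r := by
      rw [card_union (Finset.erase_subset h H), hr]
      simp only [Fintype.card_sum, Fintype.card_coe, Fintype.card_fin,
        Finset.card_erase_of_mem hh, Finset.card_erase_of_mem hh0]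
      omega
    simp [cSq, h1, hB]

lemma case_other {W : Submodule K (E → K)} {H : Finset E} {r : ℕ}
    {w : Fin r → E → K} (hw : IsBasisOf w W) (hH : Handle W H) {c : E → K}
    (hc : Rel W c) (hcH : ∀ h ∈ H, c h ≠ 0) {A : Finset E} (hA : A ⊆ H) (hAH : A ≠ H)
    (hAe : ∀ h ∈ H, A ≠ H.erase h) (B : Finset {x : E // x ∉ H}) :
    cSq w (A ∪ B.map (Function.Embedding.subtype _)) = 0 := by
  obtain ⟨h1, hh1, hA1⟩ := Finset.exists_of_ssubset (hA.ssubset_of_ne hAH)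
  have hAs : A ⊆ H.erase h1 := fun e he =>
    Finset.mem_erase.mpr ⟨by rintro rfl; exact hA1 he, hA he⟩
  obtain ⟨h2, hh2, hA2⟩ := Finset.exists_of_ssubset (hAs.ssubset_of_ne (hAe h1 hh1))
  obtain ⟨h21, hh2⟩ := Finset.mem_erase.mp hh2
  have hne1 := hcH h1 hh1
  have hne2 := hcH h2 hh2
  have hz : ∀ e, e ≠ h1 → e ≠ h2 →
      (Pi.single h1 (c h1)⁻¹ - Pi.single h2 (c h2)⁻¹ : E → K) e = 0 := by
    intro e he1 he2; simp [he1, he2]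
  refine cSq_zero hw _ (z := Pi.single h1 (c h1)⁻¹ - Pi.single h2 (c h2)⁻¹) ?_ ?_ ?_
  · refine mem_of_c hH hc hcH ?_ ?_
    · intro e he
      exact hz e (by rintro rfl; exact he hh1) (by rintro rfl; exact he hh2)
    · simp [mul_sub, Finset.sum_sub_distrib, Pi.single_apply, hne1, hne2]
  · intro h0
    have := congrFun h0 h1
    simp [h21.symm, hne1] at this
  · intro e he
    rcases Finset.mem_union.mp he with he | he
    · exact hz e (by rintro rfl; exact hA1 he) (by rintro rfl; exact hA2 he)
    · obtain ⟨x, _, rfl⟩ := Finset.mem_map.mp he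
      exact hz _ (by intro h; rw [← h] at hh1; exact x.2 hh1)
        (by intro h; rw [← h] at hh2; exact x.2 hh2)

lemma sum_split {M : Type} [AddCommMonoid M] (H : Finset E) (F : Finset E → M) :
    ∑ B : Finset E, F B = ∑ A ∈ H.powerset, ∑ B : Finset {x : E // x ∉ H},
      F (A ∪ B.map (Function.Embedding.subtype _)) := by
  rw [← Finset.sum_product']
  refine Finset.sum_nbij' (fun B => (B ∩ H, B.subtype (fun x => x ∉ H)))
    (fun P => P.1 ∪ P.2.map (Function.Embedding.subtype _)) ?_ ?_ ?_ ?_ ?_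
  · intro B _
    simp [Finset.inter_subset_right]
  · intro P _; simp
  · intro B _
    ext e
    by_cases he : e ∈ H <;> simp [he]
  · rintro ⟨A, B⟩ hAB
    have hA : A ⊆ H := by simpa using hAB
    ext e
    · by_cases he : e ∈ H
      · simp [he]
      · have : e ∉ A := fun h => he (hA h)
        simp [he, this]
    · have : (e : E) ∉ A := fun h => e.2 (hA h)
      simp [this, e.2]
  · intro B _
    congr 1
    ext e
    by_cases he : e ∈ H <;> simp [he]

lemma sum_powerset_handle {M : Type} [AddCommMonoid M] (H : Finset E) (G : Finset E → M)
    (hG : ∀ A ⊆ H, A ≠ H → (∀ h ∈ H, A ≠ H.erase h) → G A = 0) :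
    ∑ A ∈ H.powerset, G A = ∑ h ∈ H, G (H.erase h) + G H := by
  have hinj : Set.InjOn (fun h => H.erase h) (H : Set E) := by
    intro a ha b hb hab
    exact Finset.erase_injOn H ha hb hab
  have hnot : H ∉ H.image (fun h => H.erase h) := by
    intro hm
    obtain ⟨h, hh, he⟩ := Finset.mem_image.mp hm
    have : h ∈ H.erase h := by rw [he]; exact hh
    simp at this
  rw [← Finset.sum_subset (s₁ := insert H (H.image fun h => H.erase h))]
  · rw [Finset.sum_insert hnot, Finset.sum_image hinj, add_comm]
  · intro A hA
    rw [Finset.mem_powerset]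
    rcases Finset.mem_insert.mp hA with rfl | hA
    · exact Finset.Subset.refl _
    · obtain ⟨h, _, rfl⟩ := Finset.mem_image.mp hA
      exact Finset.erase_subset _ _
  · intro A hA hn
    refine hG A (Finset.mem_powerset.mp hA) ?_ ?_
    · rintro rfl; exact hn (Finset.mem_insert_self _ _)
    · rintro h hh rfl
      exact hn (Finset.mem_insert_of_mem (Finset.mem_image_of_mem _ hh))

open MvPolynomial in
lemma prod_term {H A : Finset E} (hA : A ⊆ H) (u : E → K) (hu : ∀ e ∉ H, u e = 1)
    (B : Finset {x : E // x ∉ H}) :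
    ∏ e ∈ A ∪ B.map (Function.Embedding.subtype _), (C (u e) * X e : MvPolynomial E K) =
      C (∏ e ∈ A, u e) * (∏ e ∈ A, X e) * ∏ e ∈ B, X (e : E) := by
  rw [Finset.prod_union, Finset.prod_map, Finset.prod_mul_distrib, map_prod]
  · congr 1
    refine Finset.prod_congr rfl fun e _ => ?_
    simp [hu e e.2]
  · rw [Finset.disjoint_left]
    intro e he he2
    obtain ⟨x, _, rfl⟩ := Finset.mem_map.mp he2
    exact x.2 (hA he)

/-- **Theorem (Configuration polynomials and handles).**
Let `W ⊆ K^E` realize a connected matroid and let `H` be a proper handle.  After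
suitably rescaling the coordinates `x_h`, `h ∈ H`, and up to nonzero square constant
factors, `ψ_W = ∑_{h∈H} x^{H∖{h}} · ψ_{W∖H} + x^H · ψ_{W/H}`. -/
theorem psi_handle_formula
    (W : Submodule K (E → K)) (H : Finset E) {r rd rc : ℕ}
    (w : Fin r → E → K)
    (wd : Fin rd → {x : E // x ∉ H} → K)
    (wc : Fin rc → {x : E // x ∉ H} → K)
    (hw : IsBasisOf w W)
    (hwd : IsBasisOf wd (deleteConfig W H))
    (hwc : IsBasisOf wc (contractConfig W H))
    (hconn : Connected W) (hH : Handle W H) (hproper : H ≠ Finset.univ) :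
    ∃ (u : E → K) (a b : K),
      (∀ e : E, u e ≠ 0) ∧ (∀ e ∉ H, u e = 1) ∧ a ≠ 0 ∧ b ≠ 0 ∧
      MvPolynomial.aeval (fun e : E => MvPolynomial.C (u e) * MvPolynomial.X e) (psi w) =
        MvPolynomial.C (a ^ 2) *
            (∑ h ∈ H, ∏ e ∈ H.erase h, MvPolynomial.X e) *
            MvPolynomial.rename Subtype.val (psi wd)
        + MvPolynomial.C (b ^ 2) * (∏ e ∈ H, MvPolynomial.X e) *
            MvPolynomial.rename Subtype.val (psi wc) := by
  obtain ⟨hI, c, hc, hcH⟩ := exists_c hconn hH hproper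
  obtain ⟨d1, hd1, hfull⟩ := case_full hw hwc hI
  obtain ⟨d2, hd2, herase⟩ := case_erase hw hwd hH hc hcH
  have hP : ∏ e ∈ H, c e ≠ 0 := Finset.prod_ne_zero_iff.mpr hcH
  let u : E → K := fun e => if e ∈ H then c e ^ 2 else 1
  have hu1 : ∀ e ∉ H, u e = 1 := fun e he => by simp [u, he]
  have huA : ∀ A ⊆ H, ∏ e ∈ A, u e = (∏ e ∈ A, c e) ^ 2 := by
    intro A hA
    rw [← Finset.prod_pow]
    exact Finset.prod_congr rfl fun e he => by simp [u, hA he]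
  refine ⟨u, d2 * ∏ e ∈ H, c e, d1 * ∏ e ∈ H, c e, ?_, hu1, mul_ne_zero hd2 hP,
    mul_ne_zero hd1 hP, ?_⟩
  · intro e
    by_cases he : e ∈ H
    · simpa [u, he] using hcH e he
    · simp [u, he]
  rw [psi_eq w, psi_eq wd, psi_eq wc]
  simp only [map_sum, map_mul, map_prod, MvPolynomial.aeval_X, MvPolynomial.aeval_C,
    MvPolynomial.rename_X, MvPolynomial.rename_C, MvPolynomial.algebraMap_eq]
  rw [sum_split H, sum_powerset_handle H]
  · congr 1
    · rw [mul_assoc, Finset.sum_mul, Finset.mul_sum]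
      refine Finset.sum_congr rfl fun h hh => ?_
      rw [Finset.mul_sum, Finset.mul_sum]
      refine Finset.sum_congr rfl fun B _ => ?_
      have hs := Finset.erase_subset h H
      rw [prod_term hs u hu1, herase h hh, huA _ hs, ← Finset.mul_prod_erase H c hh]
      simp only [map_mul, map_pow, map_prod]
      ring
    · rw [Finset.mul_sum]
      refine Finset.sum_congr rfl fun B _ => ?_
      rw [prod_term (Finset.Subset.refl H) u hu1, hfull, huA _ (Finset.Subset.refl H)]
      simp only [map_mul, map_pow, map_prod]
      ring
  · intro A hA hAH hAe
    refine Finset.sum_eq_zero fun B _ => ?_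
    rw [case_other hw hH hc hcH hA hAH hAe]
    simp

end Config
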